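/- arXiv:2102.02483 — 3 statements merged into one kernel-verified Lean document; each statement's English description precedes it below -/
import Mathlib

section
/- A bitopological space ⟨X, τ0, τ1⟩ is a CL-space (i.e. every theorem of the conservativity logic CL is valid in ⟨X, τ0, τ1⟩) if and only if the topological space ⟨X, τ0⟩ is scattered. -/
/-- Formulas of the modal language `L(□, ▷)`. -/
inductive Fml : Type
  | var : ℕ → Fml
  | top : Fml
  | bot : Fml
  | neg : Fml → Fml
  | and : Fml → Fml → Fml
  | or : Fml → Fml → Fml
  | imp : Fml → Fml → Fml
  | box : Fml → Fml
  | dia : Fml → Fml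
  | rhd : Fml → Fml → Fml
  deriving DecidableEq

/-- Classical propositional evaluation, treating formulas whose main connective is
modal (and propositional variables) as atoms. -/
def pEval (w : Fml → Bool) : Fml → Bool
  | .var n => w (.var n)
  | .top => true
  | .bot => false
  | .neg φ => !(pEval w φ)
  | .and φ ψ => pEval w φ && pEval w ψ
  | .or φ ψ => pEval w φ || pEval w ψ
  | .imp φ ψ => !(pEval w φ) || pEval w ψ
  | .box φ => w (.box φ)
  | .dia φ => w (.dia φ)
  | .rhd φ ψ => w (.rhd φ ψ)

/-- Classical propositional tautologies of the language `L(□, ▷)`. -/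
def Tautology (φ : Fml) : Prop := ∀ w : Fml → Bool, pEval w φ = true

/-- Uniform substitution. -/
def Fml.subst (σ : ℕ → Fml) : Fml → Fml
  | .var n => σ n
  | .top => .top
  | .bot => .bot
  | .neg φ => .neg (φ.subst σ)
  | .and φ ψ => .and (φ.subst σ) (ψ.subst σ)
  | .or φ ψ => .or (φ.subst σ) (ψ.subst σ)
  | .imp φ ψ => .imp (φ.subst σ) (ψ.subst σ)
  | .box φ => .box (φ.subst σ)
  | .dia φ => .dia (φ.subst σ)
  | .rhd φ ψ => .rhd (φ.subst σ) (ψ.subst σ)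

/-- The conservativity logic `CL`: the smallest set of formulas containing all
classical tautologies, the distribution axiom, Löb's axiom and the axioms J1–J4,
closed under modus ponens, necessitation and uniform substitution. -/
inductive CL : Fml → Prop
  | taut {φ} : Tautology φ → CL φ
  | axK (φ ψ) : CL (.imp (.box (.imp φ ψ)) (.imp (.box φ) (.box ψ)))
  | axLob (φ) : CL (.imp (.box (.imp (.box φ) φ)) (.box φ))
  | axJ1 (φ ψ) : CL (.imp (.box (.imp φ ψ)) (.rhd φ ψ))
  | axJ2 (φ ψ χ) : CL (.imp (.and (.rhd φ ψ) (.rhd ψ χ)) (.rhd φ χ))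
  | axJ3 (φ ψ χ) : CL (.imp (.and (.rhd φ χ) (.rhd ψ χ)) (.rhd (.or φ ψ) χ))
  | axJ4 (φ ψ) : CL (.imp (.rhd φ ψ) (.imp (.dia φ) (.dia ψ)))
  | mp {φ ψ} : CL (.imp φ ψ) → CL φ → CL ψ
  | nec {φ} : CL φ → CL (.box φ)
  | subst {φ} (σ : ℕ → Fml) : CL φ → CL (φ.subst σ)

/-- `L` is a normal extension of `CL`. -/
def NormalExt (L : Set Fml) : Prop :=
  (∀ φ, CL φ → φ ∈ L) ∧
    (∀ φ ψ : Fml, Fml.imp φ ψ ∈ L → φ ∈ L → ψ ∈ L) ∧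
    (∀ φ : Fml, φ ∈ L → Fml.box φ ∈ L) ∧
    (∀ (φ : Fml) (σ : ℕ → Fml), φ ∈ L → φ.subst σ ∈ L)

/-- The derived set of `Y` with respect to the topology `τ`. -/
def dSet {X : Type*} (τ : TopologicalSpace X) (Y : Set X) : Set X :=
  {x | ∀ U : Set X, τ.IsOpen U → x ∈ U → ∃ y, y ≠ x ∧ y ∈ Y ∩ U}

/-- The operation `e_{τ0,τ1}` on a bitopological space. -/
def eSet {X : Type*} (τ0 τ1 : TopologicalSpace X) (Y Z : Set X) : Set X :=
  {x | ∀ U : Set X, τ1.IsOpen U → x ∈ dSet τ0 (Y ∩ U) → x ∈ dSet τ0 (Z ∩ U)}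

/-- A valuation on the bitopological space `⟨X, τ0, τ1⟩`. -/
structure BVal (X : Type) (τ0 τ1 : TopologicalSpace X) where
  v : Fml → Set X
  hbot : v .bot = ∅
  htop : v .top = Set.univ
  hneg : ∀ φ, v (.neg φ) = (v φ)ᶜ
  hand : ∀ φ ψ, v (.and φ ψ) = v φ ∩ v ψ
  hor : ∀ φ ψ, v (.or φ ψ) = v φ ∪ v ψ
  himp : ∀ φ ψ, v (.imp φ ψ) = (v φ)ᶜ ∪ v ψ
  hbox : ∀ φ, v (.box φ) = (dSet τ0 (v φ)ᶜ)ᶜ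
  hdia : ∀ φ, v (.dia φ) = dSet τ0 (v φ)
  hrhd : ∀ φ ψ, v (.rhd φ ψ) = eSet τ0 τ1 (v φ) (v ψ)

/-- A formula is valid in `⟨X, τ0, τ1⟩` if it is true everywhere under every valuation. -/
def Valid (X : Type) (τ0 τ1 : TopologicalSpace X) (φ : Fml) : Prop :=
  ∀ val : BVal X τ0 τ1, val.v φ = Set.univ

/-- `⟨X, τ0, τ1⟩` is an `L`-space if every formula of `L` is valid in it. -/
def IsLSpace (L : Set Fml) (X : Type) (τ0 τ1 : TopologicalSpace X) : Prop :=
  ∀ φ ∈ L, Valid X τ0 τ1 φ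

/-- The topological consequence relation `Γ ⊨_L^T φ`. -/
def TConseq (L : Set Fml) (Γ : Set Fml) (φ : Fml) : Prop :=
  ∀ (X : Type), Nonempty X → ∀ (τ0 τ1 : TopologicalSpace X),
    IsLSpace L X τ0 τ1 → ∀ (val : BVal X τ0 τ1) (x : X),
      (∀ ψ ∈ Γ, x ∈ val.v ψ) → x ∈ val.v φ

/-- `Γ ⊢_L φ`: some finite conjunction of members of `Γ` implies `φ` in `L`. -/
def Proves (L : Set Fml) (Γ : Set Fml) (φ : Fml) : Prop :=
  ∃ l : List Fml, (∀ ψ ∈ l, ψ ∈ Γ) ∧ Fml.imp (l.foldr Fml.and Fml.top) φ ∈ L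

/-- A topological space is scattered if every nonempty subset `Y` satisfies
`Y \ d_τ(Y) ≠ ∅`. -/
def IsScattered {X : Type*} (τ : TopologicalSpace X) : Prop :=
  ∀ Y : Set X, Y.Nonempty → (Y \ dSet τ Y).Nonempty

section DerivedSet

variable {X : Type*} {τ : TopologicalSpace X}

theorem dSet_mono {A B : Set X} (h : A ⊆ B) : dSet τ A ⊆ dSet τ B := by
  intro x hx U hU hxU
  obtain ⟨y, hy, hyA, hyU⟩ := hx U hU hxU
  exact ⟨y, hy, h hyA, hyU⟩

theorem dSet_empty : dSet τ (∅ : Set X) = ∅ := by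
  ext x
  simp only [Set.mem_empty_iff_false, iff_false]
  intro hx
  obtain ⟨y, -, hy, -⟩ := hx Set.univ τ.isOpen_univ trivial
  exact hy

theorem dSet_union_subset (A B : Set X) : dSet τ (A ∪ B) ⊆ dSet τ A ∪ dSet τ B := by
  intro x hx
  by_contra hcon
  simp only [dSet, Set.mem_union, Set.mem_ofPred_eq, not_or, not_forall] at hcon
  obtain ⟨⟨U, hU, hxU, hA⟩, V, hV, hxV, hB⟩ := hcon
  obtain ⟨y, hy, hyAB, hyU, hyV⟩ := hx (U ∩ V) (τ.isOpen_inter U V hU hV) ⟨hxU, hxV⟩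
  rcases hyAB with h | h
  · exact hA ⟨y, hy, h, hyU⟩
  · exact hB ⟨y, hy, h, hyV⟩

theorem mem_dSet_or_mem_dSet {A B C : Set X} (h : C ⊆ A ∪ B) {x : X} (hx : x ∈ dSet τ C) :
    x ∈ dSet τ A ∨ x ∈ dSet τ B :=
  dSet_union_subset A B (dSet_mono h hx)

/-- In a scattered space every limit point of `B` is a limit point of the isolated points
of `B`. -/
theorem IsScattered.dSet_subset (hs : IsScattered τ) (B : Set X) :
    dSet τ B ⊆ dSet τ (B \ dSet τ B) := by
  intro x hx U hU hxU
  obtain ⟨y, hyY, hyd⟩ := hs (insert x (B ∩ U)) ⟨x, Set.mem_insert _ _⟩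
  simp only [dSet, Set.mem_ofPred_eq, not_forall] at hyd
  obtain ⟨V, hV, hyV, hno⟩ := hyd
  have hyx : y ≠ x := by
    rintro rfl
    obtain ⟨z, hz, hzB, hzU, hzV⟩ := hx (U ∩ V) (τ.isOpen_inter U V hU hV) ⟨hxU, hyV⟩
    exact hno ⟨z, hz, Or.inr ⟨hzB, hzU⟩, hzV⟩
  obtain ⟨hyB, hyU⟩ := hyY.resolve_left hyx
  refine ⟨y, hyx, ⟨hyB, fun hyd => ?_⟩, hyU⟩
  obtain ⟨z, hz, hzB, hzU, hzV⟩ := hyd (U ∩ V) (τ.isOpen_inter U V hU hV) ⟨hyU, hyV⟩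
  exact hno ⟨z, hz, Or.inr ⟨hzB, hzU⟩, hzV⟩

end DerivedSet

section Valuation

variable {X : Type} {τ0 τ1 : TopologicalSpace X}

/-- The valuation obtained by precomposing with a substitution. -/
def BVal.subst (val : BVal X τ0 τ1) (σ : ℕ → Fml) : BVal X τ0 τ1 where
  v φ := val.v (φ.subst σ)
  hbot := val.hbot
  htop := val.htop
  hneg _ := val.hneg _
  hand _ _ := val.hand _ _
  hor _ _ := val.hor _ _
  himp _ _ := val.himp _ _
  hbox _ := val.hbox _
  hdia _ := val.hdia _
  hrhd _ _ := val.hrhd _ _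

/-- The extension of an assignment of sets to variables to all formulas. -/
def Fml.interp (τ0 τ1 : TopologicalSpace X) (a : ℕ → Set X) : Fml → Set X
  | .var n => a n
  | .top => Set.univ
  | .bot => ∅
  | .neg φ => (φ.interp τ0 τ1 a)ᶜ
  | .and φ ψ => φ.interp τ0 τ1 a ∩ ψ.interp τ0 τ1 a
  | .or φ ψ => φ.interp τ0 τ1 a ∪ ψ.interp τ0 τ1 a
  | .imp φ ψ => (φ.interp τ0 τ1 a)ᶜ ∪ ψ.interp τ0 τ1 a
  | .box φ => (dSet τ0 (φ.interp τ0 τ1 a)ᶜ)ᶜ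
  | .dia φ => dSet τ0 (φ.interp τ0 τ1 a)
  | .rhd φ ψ => eSet τ0 τ1 (φ.interp τ0 τ1 a) (ψ.interp τ0 τ1 a)

/-- The valuation determined by an assignment of sets to variables. -/
def BVal.ofAssignment (τ0 τ1 : TopologicalSpace X) (a : ℕ → Set X) : BVal X τ0 τ1 where
  v := Fml.interp τ0 τ1 a
  hbot := rfl
  htop := rfl
  hneg _ := rfl
  hand _ _ := rfl
  hor _ _ := rfl
  himp _ _ := rfl
  hbox _ := rfl
  hdia _ := rfl
  hrhd _ _ := rfl

open Classical in
theorem BVal.mem_iff_pEval (val : BVal X τ0 τ1) (x : X) (φ : Fml) :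
    x ∈ val.v φ ↔ pEval (fun ψ => decide (x ∈ val.v ψ)) φ = true := by
  induction φ with
  | var n => simp [pEval]
  | top => simp [pEval, val.htop]
  | bot => simp [pEval, val.hbot]
  | neg φ ih => simp [pEval, val.hneg, ih]
  | and φ ψ ih₁ ih₂ => simp [pEval, val.hand, ih₁, ih₂]
  | or φ ψ ih₁ ih₂ => simp [pEval, val.hor, ih₁, ih₂]
  | imp φ ψ ih₁ ih₂ => simp [pEval, val.himp, ih₁, ih₂]
  | box φ => simp [pEval]
  | dia φ => simp [pEval]
  | rhd φ ψ => simp [pEval]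

theorem BVal.mem_imp (val : BVal X τ0 τ1) {x : X} {φ ψ : Fml} :
    x ∈ val.v (.imp φ ψ) ↔ (x ∈ val.v φ → x ∈ val.v ψ) := by
  simp [val.himp, imp_iff_not_or]

theorem BVal.mem_box (val : BVal X τ0 τ1) {x : X} {φ : Fml} :
    x ∈ val.v (.box φ) ↔ x ∉ dSet τ0 (val.v φ)ᶜ := by
  simp [val.hbox]

theorem CL.valid (hs : IsScattered τ0) {φ : Fml} (h : CL φ) : Valid X τ0 τ1 φ := by
  induction h with
  | taut h =>
    intro val
    exact Set.eq_univ_of_forall fun x => (val.mem_iff_pEval x _).2 (h _)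
  | axK φ ψ =>
    intro val
    refine Set.eq_univ_of_forall fun x => ?_
    simp only [val.mem_imp, val.mem_box]
    intro h₁ h₂ h
    refine (mem_dSet_or_mem_dSet (fun y hy => ?_) h).elim h₁ h₂
    by_cases hφ : y ∈ val.v φ
    · exact Or.inl fun hy' => hy (val.mem_imp.1 hy' hφ)
    · exact Or.inr hφ
  | axLob φ =>
    intro val
    refine Set.eq_univ_of_forall fun x => ?_
    simp only [val.mem_imp, val.mem_box]
    refine fun h₁ h => h₁ (dSet_mono (fun y hy hy' => ?_) (hs.dSet_subset _ h))
    exact hy.1 (val.mem_imp.1 hy' (val.mem_box.2 hy.2))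
  | axJ1 φ ψ =>
    intro val
    refine Set.eq_univ_of_forall fun x => ?_
    simp only [val.mem_imp, val.mem_box, val.hrhd]
    intro h₁ U _ h
    refine (mem_dSet_or_mem_dSet (fun y hy => ?_) h).resolve_left h₁
    by_cases hψ : y ∈ val.v ψ
    · exact Or.inr ⟨hψ, hy.2⟩
    · exact Or.inl fun hy' => hψ (val.mem_imp.1 hy' hy.1)
  | axJ2 φ ψ χ =>
    intro val
    refine Set.eq_univ_of_forall fun x => ?_
    simp only [val.mem_imp, val.hand, val.hrhd]
    exact fun h U hU hx => h.2 U hU (h.1 U hU hx)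
  | axJ3 φ ψ χ =>
    intro val
    refine Set.eq_univ_of_forall fun x => ?_
    simp only [val.mem_imp, val.hand, val.hor, val.hrhd]
    intro h U hU hx
    exact (mem_dSet_or_mem_dSet (Set.union_inter_distrib_right _ _ _).subset hx).elim
      (h.1 U hU) (h.2 U hU)
  | axJ4 φ ψ =>
    intro val
    refine Set.eq_univ_of_forall fun x => ?_
    simp only [val.mem_imp, val.hdia, val.hrhd]
    intro h hx
    simpa using h Set.univ τ1.isOpen_univ (by simpa using hx)
  | mp _ _ ih₁ ih₂ =>
    intro val
    have h := ih₁ val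
    rw [val.himp, ih₂ val] at h
    simpa using h
  | nec _ ih =>
    intro val
    rw [val.hbox, ih val, Set.compl_univ, dSet_empty, Set.compl_empty]
  | subst σ _ ih => exact fun val => ih (val.subst σ)

theorem isScattered_of_valid_lob
    (h : Valid X τ0 τ1 (.imp (.box (.imp (.box (.var 0)) (.var 0))) (.box (.var 0)))) :
    IsScattered τ0 := by
  intro Y hY
  by_contra hne
  have hYd : Y ⊆ dSet τ0 Y := Set.sdiff_eq_empty.1 (Set.not_nonempty_iff_eq_empty.1 hne)
  let val := BVal.ofAssignment τ0 τ1 fun _ => Yᶜ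
  have hvar : val.v (.var 0) = Yᶜ := rfl
  have himp : val.v (.imp (.box (.var 0)) (.var 0)) = Set.univ := by
    refine Set.eq_univ_of_forall fun x => val.mem_imp.2 fun hx => ?_
    rw [val.mem_box, hvar, compl_compl] at hx
    exact fun hxY => hx (hYd hxY)
  obtain ⟨x, hx⟩ := hY
  have hbox := val.mem_imp.1 (Set.eq_univ_iff_forall.1 (h val) x)
  rw [val.mem_box, val.mem_box, himp, hvar, compl_compl, Set.compl_univ, dSet_empty] at hbox
  exact hbox (Set.notMem_empty x) (hYd hx)

end Valuation

/-- A bitopological space is a `CL`-space iff its first topology is scattered. -/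
theorem CLspace_iff_scattered (X : Type) (hX : Nonempty X)
    (τ0 τ1 : TopologicalSpace X) :
    IsLSpace {φ | CL φ} X τ0 τ1 ↔ IsScattered τ0 :=
  ⟨fun h => isScattered_of_valid_lob (h _ (CL.axLob _)), fun hs _ h => CL.valid hs h⟩
end

section
/- Topological compactness theorem: Let L be a consistent normal extension of the conservativity logic CL, Γ a set of L(□,▷)-formulas, and φ an L(□,▷)-formula. If Γ ⊨_L^T φ, then there exists a finite subset Γ0 of Γ such that Γ0 ⊨_L^T φ. -/
section LocalOperations

variable {X : Type*} (τ0 τ1 : TopologicalSpace X)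

/-- The derived set is determined locally, on punctured neighbourhoods. -/
lemma mem_dSet_congr {Y Z V : Set X} {x : X} (hV : τ0.IsOpen V) (hx : x ∈ V)
    (h : ∀ y ∈ V, y ≠ x → (y ∈ Y ↔ y ∈ Z)) : x ∈ dSet τ0 Y ↔ x ∈ dSet τ0 Z := by
  constructor
  · intro hY U hU hxU
    obtain ⟨y, hne, hyY, hyU, hyV⟩ := hY (U ∩ V) (τ0.isOpen_inter _ _ hU hV) ⟨hxU, hx⟩
    exact ⟨y, hne, (h y hyV hne).1 hyY, hyU⟩
  · intro hZ U hU hxU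
    obtain ⟨y, hne, hyZ, hyU, hyV⟩ := hZ (U ∩ V) (τ0.isOpen_inter _ _ hU hV) ⟨hxU, hx⟩
    exact ⟨y, hne, (h y hyV hne).2 hyZ, hyU⟩

/-- The operation `eSet` is determined locally, on punctured `τ0`-neighbourhoods. -/
lemma mem_eSet_congr {Y Y' Z Z' V : Set X} {x : X} (hV : τ0.IsOpen V) (hx : x ∈ V)
    (hY : ∀ y ∈ V, y ≠ x → (y ∈ Y ↔ y ∈ Y')) (hZ : ∀ y ∈ V, y ≠ x → (y ∈ Z ↔ y ∈ Z')) :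
    x ∈ eSet τ0 τ1 Y Z ↔ x ∈ eSet τ0 τ1 Y' Z' := by
  refine forall_congr' fun U => forall_congr' fun _ => imp_congr ?_ ?_
  · exact mem_dSet_congr τ0 hV hx fun y hy hne => and_congr_left' (hY y hy hne)
  · exact mem_dSet_congr τ0 hV hx fun y hy hne => and_congr_left' (hZ y hy hne)

lemma dSet_mono_s15 {Y Z : Set X} (h : Y ⊆ Z) : dSet τ0 Y ⊆ dSet τ0 Z := fun _ hx U hU hxU =>
  let ⟨y, hne, hyY, hyU⟩ := hx U hU hxU
  ⟨y, hne, h hyY, hyU⟩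

end LocalOperations

/-- The value of a formula under an assignment of sets to the propositional variables. -/
def Fml.eval {X : Type*} (τ0 τ1 : TopologicalSpace X) (a : ℕ → Set X) : Fml → Set X
  | .var n => a n
  | .top => Set.univ
  | .bot => ∅
  | .neg φ => (φ.eval τ0 τ1 a)ᶜ
  | .and φ ψ => φ.eval τ0 τ1 a ∩ ψ.eval τ0 τ1 a
  | .or φ ψ => φ.eval τ0 τ1 a ∪ ψ.eval τ0 τ1 a
  | .imp φ ψ => (φ.eval τ0 τ1 a)ᶜ ∪ ψ.eval τ0 τ1 a
  | .box φ => (dSet τ0 (φ.eval τ0 τ1 a)ᶜ)ᶜ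
  | .dia φ => dSet τ0 (φ.eval τ0 τ1 a)
  | .rhd φ ψ => eSet τ0 τ1 (φ.eval τ0 τ1 a) (ψ.eval τ0 τ1 a)

/-- The valuation extending an assignment of sets to the propositional variables. -/
def BVal.ofVars {X : Type} (τ0 τ1 : TopologicalSpace X) (a : ℕ → Set X) : BVal X τ0 τ1 where
  v := Fml.eval τ0 τ1 a
  hbot := rfl
  htop := rfl
  hneg _ := rfl
  hand _ _ := rfl
  hor _ _ := rfl
  himp _ _ := rfl
  hbox _ := rfl
  hdia _ := rfl
  hrhd _ _ := rfl

/-- On a space validating Löb's axiom, the derived set of a singleton is closed. -/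
lemma exists_isOpen_diff_singleton {X : Type} (τ0 τ1 : TopologicalSpace X)
    (h : Valid X τ0 τ1 (.imp (.box (.imp (.box (.var 0)) (.var 0))) (.box (.var 0)))) (x : X) :
    ∃ V, τ0.IsOpen V ∧ x ∈ V ∧ τ0.IsOpen (V \ {x}) := by
  have key : x ∉ dSet τ0 (dSet τ0 {x}) := by
    intro hx
    set Y : Set X := insert x (dSet τ0 {x}) with hY
    have hsub : Y ⊆ dSet τ0 Y := by
      rintro y (rfl | hy)
      · exact dSet_mono_s15 τ0 (Set.subset_insert _ _) hx
      · exact dSet_mono_s15 τ0 (by simp [hY]) hy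
    have hv := h (BVal.ofVars τ0 τ1 fun _ => Yᶜ)
    have hx' := hv.ge (Set.mem_univ x)
    simp only [BVal.ofVars, Fml.eval, compl_compl, Set.compl_union] at hx'
    rw [Set.inter_comm, ← Set.sdiff_eq, Set.sdiff_eq_empty.2 hsub] at hx'
    rcases hx' with hx' | hx'
    · obtain ⟨y, -, hy, -⟩ := hx' Set.univ τ0.isOpen_univ trivial
      exact hy
    · exact hx' (hsub (Set.mem_insert _ _))
  simp only [dSet, Set.mem_ofPred_eq] at key
  push Not at key
  obtain ⟨V, hV, hxV, hVd⟩ := key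
  refine ⟨V, hV, hxV, (@isOpen_iff_forall_mem_open X τ0 _).2 ?_⟩
  rintro y ⟨hyV, hyx⟩
  have hy : ¬ ∀ U : Set X, τ0.IsOpen U → y ∈ U → ∃ z, z ≠ y ∧ z ∈ {x} ∩ U :=
    fun hy => hVd y hyx ⟨hy, hyV⟩
  push Not at hy
  obtain ⟨U, hU, hyU, hUx⟩ := hy
  refine ⟨U ∩ V, ?_, τ0.isOpen_inter _ _ hU hV, hyU, hyV⟩
  rintro z ⟨hzU, hzV⟩
  refine ⟨hzV, ?_⟩
  rintro rfl
  exact hUx z (Ne.symm hyx) ⟨rfl, hzU⟩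

section UltraSum

variable {ι : Type} {X : ι → Type}

/-- The trace on the `i`-th summand of a subset of a disjoint sum with an extra point. -/
def fiber (W : Set (Option (Σ i, X i))) (i : ι) : Set (X i) := {y | some ⟨i, y⟩ ∈ W}

/-- The set with given traces that contains the extra point iff `b` holds. -/
def ofFibers (b : Prop) (W : ∀ i, Set (X i)) : Set (Option (Σ i, X i)) :=
  {z | match z with
    | none => b
    | some ⟨i, y⟩ => y ∈ W i}

@[simp] lemma fiber_ofFibers (b : Prop) (W : ∀ i, Set (X i)) : fiber (ofFibers b W) = W := rfl

@[simp] lemma none_mem_ofFibers (b : Prop) (W : ∀ i, Set (X i)) :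
    none ∈ ofFibers b W ↔ b := Iff.rfl

@[simp] lemma fiber_sUnion (S : Set (Set (Option (Σ i, X i)))) (i : ι) :
    fiber (⋃₀ S) i = ⋃₀ ((fun W => fiber W i) '' S) := by
  ext; simp [fiber]

/-- The disjoint sum of the spaces `X i` with an extra point, whose punctured neighbourhoods
are the `F`-limits of the punctured neighbourhoods of the points `x i`. -/
@[reducible] def ultraSum (τ : ∀ i, TopologicalSpace (X i)) (x : ∀ i, X i) (F : Ultrafilter ι) :
    TopologicalSpace (Option (Σ i, X i)) where
  IsOpen U := (∀ i, (τ i).IsOpen (fiber U i)) ∧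
    (none ∈ U → ∀ᶠ i in (F : Filter ι), (τ i).IsOpen (insert (x i) (fiber U i)))
  isOpen_univ := by
    refine ⟨fun i => (τ i).isOpen_univ, fun _ => .of_forall fun i => ?_⟩
    convert (τ i).isOpen_univ
    exact Set.eq_univ_of_forall fun _ => Or.inr trivial
  isOpen_inter U V hU hV := by
    refine ⟨fun i => (τ i).isOpen_inter _ _ (hU.1 i) (hV.1 i), fun h => ?_⟩
    filter_upwards [hU.2 h.1, hV.2 h.2] with i hi hi'
    convert (τ i).isOpen_inter _ _ hi hi' using 1
    exact Set.insert_inter_distrib _ _ _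
  isOpen_sUnion S hS := by
    have hopen (i : ι) : (τ i).IsOpen (fiber (⋃₀ S) i) := by
      rw [fiber_sUnion]
      refine (τ i).isOpen_sUnion _ ?_
      rintro _ ⟨W, hW, rfl⟩
      exact (hS W hW).1 i
    refine ⟨hopen, ?_⟩
    rintro ⟨U, hUS, hU⟩
    filter_upwards [(hS U hUS).2 hU] with i hi
    have hunion := @IsOpen.union _ _ _ (τ i) hi (hopen i)
    have hsub : fiber U i ⊆ fiber (⋃₀ S) i := fun y hy => ⟨U, hUS, hy⟩
    rwa [Set.insert_union, Set.union_eq_self_of_subset_left hsub] at hunion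

/-- The disjoint sum of the spaces `X i` with an extra isolated point. -/
@[reducible] def pointedSum (τ : ∀ i, TopologicalSpace (X i)) : TopologicalSpace (Option (Σ i, X i)) where
  IsOpen U := ∀ i, (τ i).IsOpen (fiber U i)
  isOpen_univ i := (τ i).isOpen_univ
  isOpen_inter U V hU hV i := (τ i).isOpen_inter _ _ (hU i) (hV i)
  isOpen_sUnion S hS i := by
    rw [fiber_sUnion]
    refine (τ i).isOpen_sUnion _ ?_
    rintro _ ⟨W, hW, rfl⟩
    exact hS W hW i

variable (τ0 τ1 : ∀ i, TopologicalSpace (X i)) (x : ∀ i, X i) (F : Ultrafilter ι)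

/-- An open subset of one summand is the only non-empty trace of some set with open traces. -/
lemma exists_fiber_eq (τ : ∀ i, TopologicalSpace (X i)) {i : ι} {U : Set (X i)}
    (hU : (τ i).IsOpen U) : ∃ W : Set (Option (Σ i, X i)), none ∉ W ∧ fiber W i = U ∧
      (∀ j, (τ j).IsOpen (fiber W j)) ∧ ∀ z ∈ W, ∃ y ∈ U, z = some ⟨i, y⟩ := by
  classical
  refine ⟨ofFibers False (Function.update (fun _ => ∅) i U), id, by simp, fun j => ?_, ?_⟩
  · rcases eq_or_ne j i with rfl | hj
    · simpa
    · rw [fiber_ofFibers, Function.update_of_ne hj]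
      exact @isOpen_empty _ (τ j)
  · rintro (_ | ⟨j, y⟩) hz
    · exact hz.elim
    · rcases eq_or_ne j i with rfl | hj
      · exact ⟨y, by simpa [ofFibers] using hz, rfl⟩
      · simp [ofFibers, hj] at hz

lemma some_mem_dSet_ultraSum {i : ι} {y : X i} {W : Set (Option (Σ i, X i))} :
    some ⟨i, y⟩ ∈ dSet (ultraSum τ0 x F) W ↔ y ∈ dSet (τ0 i) (fiber W i) := by
  constructor
  · intro h U hU hy
    obtain ⟨V, hnone, rfl, hV, hVU⟩ := exists_fiber_eq τ0 hU
    obtain ⟨z, hne, hzW, hzV⟩ := h V ⟨hV, fun h' => (hnone h').elim⟩ hy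
    obtain ⟨u, hu, rfl⟩ := hVU z hzV
    exact ⟨u, by rintro rfl; exact hne rfl, hzW, hu⟩
  · intro h U hU hy
    obtain ⟨u, hne, huW, huU⟩ := h (fiber U i) (hU.1 i) hy
    exact ⟨some ⟨i, u⟩, by simpa using hne, huW, huU⟩

lemma some_mem_eSet_ultraSum {i : ι} {y : X i} {Y Z : Set (Option (Σ i, X i))} :
    some ⟨i, y⟩ ∈ eSet (ultraSum τ0 x F) (pointedSum τ1) Y Z ↔
      y ∈ eSet (τ0 i) (τ1 i) (fiber Y i) (fiber Z i) := by
  constructor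
  · intro h U hU hy
    obtain ⟨V, -, rfl, hV, -⟩ := exists_fiber_eq τ1 hU
    exact (some_mem_dSet_ultraSum τ0 x F).1 (h V hV ((some_mem_dSet_ultraSum τ0 x F).2 hy))
  · intro h U hU hy
    exact (some_mem_dSet_ultraSum τ0 x F).2
      (h (fiber U i) (hU i) ((some_mem_dSet_ultraSum τ0 x F).1 hy))

variable {x}

lemma none_mem_dSet_ultraSum
    (hx : ∀ i, ∃ V, (τ0 i).IsOpen V ∧ x i ∈ V ∧ (τ0 i).IsOpen (V \ {x i}))
    {W : Set (Option (Σ i, X i))} :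
    none ∈ dSet (ultraSum τ0 x F) W ↔ ∀ᶠ i in (F : Filter ι), x i ∈ dSet (τ0 i) (fiber W i) := by
  constructor
  · intro h
    by_contra hF
    rw [← Ultrafilter.eventually_not] at hF
    have hV (i : ι) : ∃ V, (τ0 i).IsOpen V ∧ x i ∈ V ∧ (τ0 i).IsOpen (V \ {x i}) ∧
        (x i ∉ dSet (τ0 i) (fiber W i) → ∀ y ∈ V, y ≠ x i → y ∉ fiber W i) := by
      obtain ⟨V, hV, hxV, hV'⟩ := hx i
      by_cases hi : x i ∈ dSet (τ0 i) (fiber W i)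
      · exact ⟨V, hV, hxV, hV', fun h => (h hi).elim⟩
      · simp only [dSet, Set.mem_ofPred_eq] at hi
        push Not at hi
        obtain ⟨U, hU, hxU, hUW⟩ := hi
        refine ⟨V ∩ U, (τ0 i).isOpen_inter _ _ hV hU, ⟨hxV, hxU⟩, ?_,
          fun _ y hy hne hyW => hUW y hne ⟨hyW, hy.2⟩⟩
        rw [Set.inter_sdiff_right_comm]
        exact (τ0 i).isOpen_inter _ _ hV' hU
    choose V hV hxV hV' hVW using hV
    obtain ⟨B, hB, hBW⟩ : ∃ B : Set ι, B ∈ F ∧ ∀ i ∈ B, x i ∉ dSet (τ0 i) (fiber W i) :=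
      ⟨_, hF, fun _ h => h⟩
    have hfib (i : ι) (hi : i ∈ B) : {y ∈ V i \ {x i} | i ∈ B} = V i \ {x i} := by
      ext; simp [hi]
    have hfib' (i : ι) (hi : i ∉ B) : {y ∈ V i \ {x i} | i ∈ B} = ∅ := by
      ext; simp [hi]
    have hopen : (ultraSum τ0 x F).IsOpen (ofFibers True fun i => {y ∈ V i \ {x i} | i ∈ B}) := by
      refine ⟨fun i => ?_, fun _ => ?_⟩
      · by_cases hi : i ∈ B
        · rw [fiber_ofFibers, hfib i hi]
          exact hV' i
        · rw [fiber_ofFibers, hfib' i hi]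
          exact @isOpen_empty _ (τ0 i)
      · filter_upwards [hB] with i hi
        rw [fiber_ofFibers, hfib i hi, Set.insert_sdiff_singleton, Set.insert_eq_of_mem (hxV i)]
        exact hV i
    obtain ⟨_ | ⟨i, y⟩, hne, hyW, ⟨hyV, hyx⟩, hi⟩ := h _ hopen trivial
    · exact hne rfl
    · exact hVW i (hBW i hi) y hyV hyx hyW
  · intro h U hU hnone
    obtain ⟨i, hi, hi'⟩ := (h.and (hU.2 hnone)).exists
    obtain ⟨y, hne, hyW, hyU⟩ := hi _ hi' (Set.mem_insert _ _)
    exact ⟨some ⟨i, y⟩, by simp, hyW, hyU.resolve_left hne⟩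

lemma none_mem_eSet_ultraSum
    (hx : ∀ i, ∃ V, (τ0 i).IsOpen V ∧ x i ∈ V ∧ (τ0 i).IsOpen (V \ {x i}))
    {Y Z : Set (Option (Σ i, X i))} :
    none ∈ eSet (ultraSum τ0 x F) (pointedSum τ1) Y Z ↔
      ∀ᶠ i in (F : Filter ι), x i ∈ eSet (τ0 i) (τ1 i) (fiber Y i) (fiber Z i) := by
  constructor
  · intro h
    by_contra hF
    rw [← Ultrafilter.eventually_not] at hF
    have hU (i : ι) : ∃ U, (τ1 i).IsOpen U ∧
        (x i ∉ eSet (τ0 i) (τ1 i) (fiber Y i) (fiber Z i) →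
          x i ∈ dSet (τ0 i) (fiber Y i ∩ U) ∧ x i ∉ dSet (τ0 i) (fiber Z i ∩ U)) := by
      by_cases hi : x i ∈ eSet (τ0 i) (τ1 i) (fiber Y i) (fiber Z i)
      · exact ⟨Set.univ, (τ1 i).isOpen_univ, fun h => (h hi).elim⟩
      · have hi' := hi
        simp only [eSet, Set.mem_ofPred_eq] at hi'
        push Not at hi'
        obtain ⟨U, hU, hYZ⟩ := hi'
        exact ⟨U, hU, fun _ => hYZ⟩
    choose U hU hYZ using hU
    have hZ := (none_mem_dSet_ultraSum τ0 F hx).1 <| h (ofFibers False U) hU <|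
      (none_mem_dSet_ultraSum τ0 F hx).2 <| hF.mono fun i hi => (hYZ i hi).1
    obtain ⟨i, hi, hi'⟩ := (hF.and hZ).exists
    exact (hYZ i hi).2 hi'
  · intro h U hU hY
    refine (none_mem_dSet_ultraSum τ0 F hx).2 ?_
    filter_upwards [h, (none_mem_dSet_ultraSum τ0 F hx).1 hY] with i hi hYi
    exact hi (fiber U i) (hU i) hYi

variable {τ0 τ1 F}

/-- The restriction of a valuation on the sum to a summand. -/
def BVal.restrict (val : BVal _ (ultraSum τ0 x F) (pointedSum τ1)) (i : ι) :
    BVal (X i) (τ0 i) (τ1 i) where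
  v φ := fiber (val.v φ) i
  hbot := by rw [val.hbot]; rfl
  htop := by rw [val.htop]; rfl
  hneg φ := by rw [val.hneg]; rfl
  hand φ ψ := by rw [val.hand]; rfl
  hor φ ψ := by rw [val.hor]; rfl
  himp φ ψ := by rw [val.himp]; rfl
  hbox φ := by
    ext y
    rw [val.hbox]
    exact not_congr (some_mem_dSet_ultraSum τ0 x F)
  hdia φ := by
    ext y
    rw [val.hdia]
    exact some_mem_dSet_ultraSum τ0 x F
  hrhd φ ψ := by
    ext y
    rw [val.hrhd]
    exact some_mem_eSet_ultraSum τ0 τ1 x F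

/-- Truth at a point depends only on the variables' values on a `τ0`-open neighbourhood. -/
lemma BVal.mem_congr {X : Type} {τ0 τ1 : TopologicalSpace X} (val val' : BVal X τ0 τ1)
    {V : Set X} (hV : τ0.IsOpen V)
    (h : ∀ n, ∀ y ∈ V, y ∈ val.v (.var n) ↔ y ∈ val'.v (.var n)) (φ : Fml) :
    ∀ y ∈ V, y ∈ val.v φ ↔ y ∈ val'.v φ := by
  induction φ with
  | var n => exact h n
  | top => simp [val.htop, val'.htop]
  | bot => simp [val.hbot, val'.hbot]
  | neg φ ih => intro y hy; simp [val.hneg, val'.hneg, ih y hy]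
  | and φ ψ ih ih' => intro y hy; simp [val.hand, val'.hand, ih y hy, ih' y hy]
  | or φ ψ ih ih' => intro y hy; simp [val.hor, val'.hor, ih y hy, ih' y hy]
  | imp φ ψ ih ih' => intro y hy; simp [val.himp, val'.himp, ih y hy, ih' y hy]
  | box φ ih =>
    intro y hy
    rw [val.hbox, val'.hbox]
    exact not_congr (mem_dSet_congr τ0 hV hy fun z hz _ => not_congr (ih z hz))
  | dia φ ih =>
    intro y hy
    rw [val.hdia, val'.hdia]
    exact mem_dSet_congr τ0 hV hy fun z hz _ => ih z hz
  | rhd φ ψ ih ih' =>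
    intro y hy
    rw [val.hrhd, val'.hrhd]
    exact mem_eSet_congr τ0 τ1 hV hy (fun z hz _ => ih z hz) fun z hz _ => ih' z hz

/-- Truth at the extra point is the `F`-limit of truth at the points `x i`. -/
lemma BVal.none_mem_iff
    (hx : ∀ i, ∃ V, (τ0 i).IsOpen V ∧ x i ∈ V ∧ (τ0 i).IsOpen (V \ {x i}))
    (val : BVal _ (ultraSum τ0 x F) (pointedSum τ1)) (w : ∀ i, BVal (X i) (τ0 i) (τ1 i))
    (hsome : ∀ n i y, y ≠ x i → (some ⟨i, y⟩ ∈ val.v (.var n) ↔ y ∈ (w i).v (.var n)))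
    (hnone : ∀ n, none ∈ val.v (.var n) ↔ ∀ᶠ i in (F : Filter ι), x i ∈ (w i).v (.var n))
    (φ : Fml) : none ∈ val.v φ ↔ ∀ᶠ i in (F : Filter ι), x i ∈ (w i).v φ := by
  have hloc (i : ι) : ∃ V, (τ0 i).IsOpen V ∧ x i ∈ V ∧
      ∀ φ, ∀ y ∈ V, y ≠ x i → (y ∈ fiber (val.v φ) i ↔ y ∈ (w i).v φ) := by
    obtain ⟨V, hV, hxV, hV'⟩ := hx i
    exact ⟨V, hV, hxV, fun φ y hy hne => (val.restrict i).mem_congr (w i) hV'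
      (fun n z hz => hsome n i z hz.2) φ y ⟨hy, hne⟩⟩
  choose V hV hxV hVw using hloc
  induction φ with
  | var n => exact hnone n
  | top => simp [val.htop, (w _).htop]
  | bot => simp [val.hbot, (w _).hbot, F.neBot.ne]
  | neg φ ih => simp only [val.hneg, (w _).hneg, Set.mem_compl_iff, ih, Ultrafilter.eventually_not]
  | and φ ψ ih ih' => simp [val.hand, (w _).hand, ih, ih']
  | or φ ψ ih ih' => simp [val.hor, (w _).hor, ih, ih', Ultrafilter.eventually_or]
  | imp φ ψ ih ih' =>
    simp only [val.himp, (w _).himp, Set.mem_union, Set.mem_compl_iff, ih, ih',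
      Ultrafilter.eventually_or, Ultrafilter.eventually_not]
  | box φ _ =>
    simp only [val.hbox, (w _).hbox, Set.mem_compl_iff, Ultrafilter.eventually_not,
      none_mem_dSet_ultraSum τ0 F hx]
    refine not_congr (Filter.eventually_congr (.of_forall fun i => ?_))
    exact mem_dSet_congr (τ0 i) (hV i) (hxV i) fun y hy hne => not_congr (hVw i φ y hy hne)
  | dia φ _ =>
    simp only [val.hdia, (w _).hdia, none_mem_dSet_ultraSum τ0 F hx]
    refine Filter.eventually_congr (.of_forall fun i => ?_)
    exact mem_dSet_congr (τ0 i) (hV i) (hxV i) (hVw i φ)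
  | rhd φ ψ _ _ =>
    simp only [val.hrhd, (w _).hrhd, none_mem_eSet_ultraSum τ0 τ1 F hx]
    refine Filter.eventually_congr (.of_forall fun i => ?_)
    exact mem_eSet_congr (τ0 i) (τ1 i) (hV i) (hxV i) (hVw i φ) (hVw i ψ)

/-- The class of `L`-spaces is closed under ultrafilter sums. -/
lemma isLSpace_ultraSum {L : Set Fml}
    (hx : ∀ i, ∃ V, (τ0 i).IsOpen V ∧ x i ∈ V ∧ (τ0 i).IsOpen (V \ {x i}))
    (hL : ∀ i, IsLSpace L (X i) (τ0 i) (τ1 i)) :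
    IsLSpace L (Option (Σ i, X i)) (ultraSum τ0 x F) (pointedSum τ1) := by
  intro φ hφ val
  refine Set.eq_univ_of_forall ?_
  rintro (_ | ⟨i, y⟩)
  · let w (i : ι) : BVal (X i) (τ0 i) (τ1 i) := BVal.ofVars (τ0 i) (τ1 i) fun n =>
      {y | (y ≠ x i ∧ some ⟨i, y⟩ ∈ val.v (.var n)) ∨ (y = x i ∧ none ∈ val.v (.var n))}
    refine (BVal.none_mem_iff hx val w ?_ ?_ φ).2
      (.of_forall fun i => (hL i φ hφ (w i)).ge (Set.mem_univ _))
    · intro n i y hy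
      simp [w, BVal.ofVars, Fml.eval, hy]
    · intro n
      simp [w, BVal.ofVars, Fml.eval]
  · exact (hL i φ hφ (val.restrict i)).ge (Set.mem_univ y)

end UltraSum

/-- Topological compactness theorem: if `L` is a consistent normal extension of `CL`
and `Γ ⊨_L^T φ`, then `Γ0 ⊨_L^T φ` for some finite subset `Γ0 ⊆ Γ`. -/
theorem topological_compactness (L : Set Fml) (hL : NormalExt L)
    (hcons : Fml.bot ∉ L) (Γ : Set Fml) (φ : Fml) (h : TConseq L Γ φ) :
    ∃ Γ0 : Finset Fml, ↑Γ0 ⊆ Γ ∧ TConseq L ↑Γ0 φ := by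
  by_contra! hfin
  have hex (s : Finset Γ) := hfin (s.map (Function.Embedding.subtype _)) (by simp)
  simp only [TConseq] at hex
  push Not at hex
  choose X _ τ0 τ1 hLS val x hΓ hφ using hex
  have hx (s : Finset Γ) :=
    exists_isOpen_diff_singleton (τ0 s) (τ1 s) (hLS s _ (hL.1 _ (.axLob _))) (x s)
  let F : Ultrafilter (Finset Γ) := .of Filter.atTop
  let w := BVal.ofVars (ultraSum τ0 x F) (pointedSum τ1) fun n =>
    ofFibers (∀ᶠ s in (F : Filter _), x s ∈ (val s).v (.var n)) fun s => (val s).v (.var n)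
  have hw := w.none_mem_iff hx val (fun _ _ _ _ => Iff.rfl) fun _ => Iff.rfl
  have hnone := h _ ⟨none⟩ _ _ (isLSpace_ultraSum hx hLS) w none fun ψ hψ => (hw ψ).2 <|
    Ultrafilter.of_le _ <| (Filter.eventually_ge_atTop {⟨ψ, hψ⟩}).mono fun s hs =>
      hΓ s ψ (by simpa [hψ] using hs)
  obtain ⟨s, hs⟩ := ((hw φ).1 hnone).exists
  exact hφ s hs
end

section
/- Let {⟨X_n, τ_n⟩}_{n ∈ ℕ} be a countable family of pairwise disjoint scattered topological spaces, let x_n ∈ X_n for each n, let Y_n ⊆ X_n be such that Y_n is a τ_n-neighborhood of x_n and Y_n \ {x_n} ∈ τ_n, let 𝒰 be a non-principal ultrafilter on ℕ, and let x_* be a new point not in ⋃_n X_n. Put X := ⋃_n (X_n \ {x_n}) ∪ {x_*}, and for V ⊆ X define V↾Y_n := V ∩ Y_n if x_* ∉ V, and V↾Y_n := ((V \ {x_*}) ∪ {x_n}) ∩ Y_n if x_* ∈ V. Define τ := {U ⊆ X | (i) for each n, U ∩ (Y_n \ {x_n}) ∈ τ_n, and (ii) if x_* ∈ U then {n ∈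 ℕ | U↾Y_n ∈ τ_n} ∈ 𝒰}. Then τ is a topology on X, and the topological space ⟨X, τ⟩ is scattered. -/
/-- `T` is a topology on the subset `Xs` of the ambient type `A`: its members are
subsets of `Xs`, it contains `Xs` and `∅`, and it is closed under binary
intersections and arbitrary unions. -/
def IsTopOn {A : Type*} (Xs : Set A) (T : Set (Set A)) : Prop :=
  (∀ U ∈ T, U ⊆ Xs) ∧ Xs ∈ T ∧ (∅ : Set A) ∈ T ∧
    (∀ U V : Set A, U ∈ T → V ∈ T → U ∩ V ∈ T) ∧
    (∀ S : Set (Set A), S ⊆ T → ⋃₀ S ∈ T)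

/-- The derived set of `Y` with respect to the collection `T` of open sets. -/
def dOn {A : Type*} (T : Set (Set A)) (Y : Set A) : Set A :=
  {x | ∀ U ∈ T, x ∈ U → ∃ y, y ≠ x ∧ y ∈ Y ∩ U}

/-- `⟨Xs, T⟩` is scattered: every nonempty `Y ⊆ Xs` satisfies `Y \ d_T(Y) ≠ ∅`. -/
def ScatteredOn {A : Type*} (Xs : Set A) (T : Set (Set A)) : Prop :=
  ∀ Y : Set A, Y ⊆ Xs → Y.Nonempty → (Y \ dOn T Y).Nonempty

open Classical in
/-- The restriction `V ↾ Y_n`, identifying the glued point `xs` with `x n`. -/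
noncomputable def resY {A : Type*} (xs : A) (x : ℕ → A) (Y : ℕ → Set A)
    (V : Set A) (n : ℕ) : Set A :=
  if xs ∈ V then ((V \ {xs}) ∪ {x n}) ∩ Y n else V ∩ Y n

/-- The ultrabouquet topology on
`X := ⋃ n, (X_n \ {x n}) ∪ {xs}`. -/
noncomputable def bouquetTop {A : Type*} (xs : A) (x : ℕ → A) (Y : ℕ → Set A)
    (T : ℕ → Set (Set A)) (𝒰 : Ultrafilter ℕ) (Xbig : Set A) : Set (Set A) :=
  {U | U ⊆ Xbig ∧ (∀ n : ℕ, U ∩ (Y n \ {x n}) ∈ T n) ∧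
    (xs ∈ U → {n : ℕ | resY xs x Y U n ∈ T n} ∈ 𝒰)}

theorem IsTopOn.union_mem {A : Type*} {X : Set A} {T : Set (Set A)} (h : IsTopOn X T)
    {U V : Set A} (hU : U ∈ T) (hV : V ∈ T) : U ∪ V ∈ T := by
  rw [← Set.sUnion_pair]
  exact h.2.2.2.2 _ (by rintro W (rfl | rfl) <;> assumption)

theorem IsTopOn.sUnion_inter_mem {A : Type*} {X : Set A} {T : Set (Set A)} (h : IsTopOn X T)
    {S : Set (Set A)} {B : Set A} (hS : ∀ U ∈ S, U ∩ B ∈ T) : ⋃₀ S ∩ B ∈ T := by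
  have heq : ⋃₀ S ∩ B = ⋃₀ ((fun U => U ∩ B) '' S) := by
    rw [Set.sUnion_image, Set.sUnion_eq_biUnion, Set.iUnion₂_inter]
  rw [heq]
  refine h.2.2.2.2 _ ?_
  rintro _ ⟨U, hU, rfl⟩
  exact hS U hU

theorem resY_of_mem {A : Type*} {xs : A} (x : ℕ → A) (Y : ℕ → Set A) {V : Set A}
    (h : xs ∈ V) (n : ℕ) : resY xs x Y V n = ((V \ {xs}) ∪ {x n}) ∩ Y n := if_pos h

theorem resY_inter {A : Type*} {xs : A} (x : ℕ → A) (Y : ℕ → Set A) {U V : Set A}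
    (hU : xs ∈ U) (hV : xs ∈ V) (n : ℕ) :
    resY xs x Y (U ∩ V) n = resY xs x Y U n ∩ resY xs x Y V n := by
  rw [resY_of_mem x Y (Set.mem_inter hU hV), resY_of_mem x Y hU, resY_of_mem x Y hV]
  ext y
  simp only [Set.mem_inter_iff, Set.mem_union, Set.mem_sdiff, Set.mem_singleton_iff]
  tauto

theorem resY_sUnion {A : Type*} {xs : A} (x : ℕ → A) (Y : ℕ → Set A) {S : Set (Set A)}
    {U : Set A} (hUS : U ∈ S) (hU : xs ∈ U) {n : ℕ} (hn : xs ∉ Y n) :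
    resY xs x Y (⋃₀ S) n = resY xs x Y U n ∪ ⋃₀ S ∩ (Y n \ {x n}) := by
  rw [resY_of_mem x Y (Set.mem_sUnion_of_mem hU hUS), resY_of_mem x Y hU]
  ext y
  simp only [Set.mem_inter_iff, Set.mem_union, Set.mem_sdiff, Set.mem_singleton_iff]
  constructor
  · tauto
  · rintro (⟨⟨hy, hne⟩ | hy, hyY⟩ | ⟨hyS, hyY, -⟩)
    · exact ⟨Or.inl ⟨Set.mem_sUnion_of_mem hy hUS, hne⟩, hyY⟩
    · exact ⟨Or.inr hy, hyY⟩
    · exact ⟨Or.inl ⟨hyS, fun h => hn (h ▸ hyY)⟩, hyY⟩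

/-- The ultrabouquet of a countable family of pairwise disjoint scattered spaces,
glued at the points `x n` via a non-principal ultrafilter, is a scattered
topological space. -/
theorem bouquet_topology_scattered {A : Type*}
    (Xs : ℕ → Set A) (T : ℕ → Set (Set A))
    (htop : ∀ n, IsTopOn (Xs n) (T n))
    (hsc : ∀ n, ScatteredOn (Xs n) (T n))
    (hdisj : ∀ m n : ℕ, m ≠ n → Disjoint (Xs m) (Xs n))
    (x : ℕ → A) (hx : ∀ n, x n ∈ Xs n)
    (Y : ℕ → Set A) (hYsub : ∀ n, Y n ⊆ Xs n)
    (hYnbhd : ∀ n, ∃ U ∈ T n, x n ∈ U ∧ U ⊆ Y n)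
    (hYopen : ∀ n, Y n \ {x n} ∈ T n)
    (𝒰 : Ultrafilter ℕ) (hnp : ∀ s : Set ℕ, s.Finite → s ∉ 𝒰)
    (xs : A) (hxs : xs ∉ ⋃ n, Xs n) :
    IsTopOn ((⋃ n, Xs n \ {x n}) ∪ {xs})
        (bouquetTop xs x Y T 𝒰 ((⋃ n, Xs n \ {x n}) ∪ {xs})) ∧
      ScatteredOn ((⋃ n, Xs n \ {x n}) ∪ {xs})
        (bouquetTop xs x Y T 𝒰 ((⋃ n, Xs n \ {x n}) ∪ {xs})) := by
  have hxsX (n : ℕ) : xs ∉ Xs n := fun h => hxs (Set.mem_iUnion_of_mem n h)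
  have hxsY (n : ℕ) : xs ∉ Y n := fun h => hxsX n (hYsub n h)
  have hidx {m n : ℕ} {a : A} (hm : a ∈ Xs m) (hn : a ∈ Xs n) : m = n := by
    by_contra hne
    exact Set.disjoint_left.mp (hdisj m n hne) hm hn
  set X : Set A := (⋃ n, Xs n \ {x n}) ∪ {xs}
  have hYX (n : ℕ) : Y n \ {x n} ⊆ X := fun y hy =>
    Or.inl (Set.mem_iUnion_of_mem n ⟨hYsub n hy.1, hy.2⟩)
  have hxsmem : xs ∈ X := Or.inr rfl
  have hYT (n : ℕ) : Y n ∈ T n := by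
    obtain ⟨U, hU, hxU, hUY⟩ := hYnbhd n
    have heq : Y n = U ∪ Y n \ {x n} := by
      ext y
      by_cases hy : y = x n
      · subst hy
        simp [hxU, hUY hxU]
      · simpa [hy] using @hUY y
    rw [heq]
    exact (htop n).union_mem hU (hYopen n)
  have hXmem : X ∈ bouquetTop xs x Y T 𝒰 X := by
    refine ⟨subset_rfl, fun n => ?_, fun _ => Filter.univ_mem' fun n => ?_⟩
    · rw [Set.inter_eq_right.mpr (hYX n)]
      exact hYopen n
    · have heq : resY xs x Y X n = Y n := by
        rw [resY_of_mem x Y hxsmem]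
        refine Set.inter_eq_right.mpr fun y hy => ?_
        by_cases hyx : y = x n
        · exact Or.inr hyx
        · exact Or.inl ⟨hYX n ⟨hy, hyx⟩, fun h => hxsY n (h ▸ hy)⟩
      change resY xs x Y X n ∈ T n
      rw [heq]
      exact hYT n
  refine ⟨⟨fun U hU => hU.1, hXmem, ?_, ?_, ?_⟩, ?_⟩
  · refine ⟨Set.empty_subset _, fun n => ?_, fun h => h.elim⟩
    rw [Set.empty_inter]
    exact (htop n).2.2.1
  · rintro U V ⟨hUX, hU, hU'⟩ ⟨hVX, hV, hV'⟩
    refine ⟨Set.inter_subset_left.trans hUX, fun n => ?_, fun h => ?_⟩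
    · rw [Set.inter_inter_distrib_right]
      exact (htop n).2.2.2.1 _ _ (hU n) (hV n)
    · filter_upwards [hU' h.1, hV' h.2] with n hnU hnV
      rw [resY_inter x Y h.1 h.2]
      exact (htop n).2.2.2.1 _ _ hnU hnV
  · intro S hS
    have hSn (n : ℕ) : ⋃₀ S ∩ (Y n \ {x n}) ∈ T n :=
      (htop n).sUnion_inter_mem fun U hU => (hS hU).2.1 n
    refine ⟨Set.sUnion_subset fun U hU => (hS hU).1, hSn, ?_⟩
    rintro ⟨U, hUS, hU⟩
    filter_upwards [(hS hUS).2.2 hU] with n hn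
    rw [resY_sUnion x Y hUS hU (hxsY n)]
    exact (htop n).union_mem hn (hSn n)
  · intro Z hZX hZ
    by_cases hZY : ∃ n, (Z ∩ (Y n \ {x n})).Nonempty
    · obtain ⟨n, hn⟩ := hZY
      obtain ⟨p, hpZ, hp⟩ := hsc n _ (fun y hy => hYsub n hy.2.1) hn
      refine ⟨p, hpZ.1, fun hd => hp fun U hU hpU => ?_⟩
      suffices hmem : U ∩ (Y n \ {x n}) ∈ bouquetTop xs x Y T 𝒰 X by
        obtain ⟨y, hyp, hyZ, hyU, hyY⟩ := hd _ hmem ⟨hpU, hpZ.2⟩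
        exact ⟨y, hyp, ⟨hyZ, hyY⟩, hyU⟩
      refine ⟨Set.inter_subset_right.trans (hYX n), fun m => ?_,
        fun h => (hxsY n h.2.1).elim⟩
      by_cases hmn : m = n
      · subst hmn
        rw [Set.inter_assoc, Set.inter_self]
        exact (htop m).2.2.2.1 _ _ hU (hYopen m)
      · have heq : U ∩ (Y n \ {x n}) ∩ (Y m \ {x m}) = ∅ :=
          Set.eq_empty_of_forall_notMem fun y hy =>
            hmn (hidx (hYsub m hy.2.1) (hYsub n hy.1.2.1))
        rw [heq]
        exact (htop m).2.2.1
    · by_cases hZxs : ∃ z ∈ Z, z ≠ xs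
      · obtain ⟨z, hz, hzne⟩ := hZxs
        refine ⟨z, hz, fun hd => ?_⟩
        suffices hmem : {z} ∈ bouquetTop xs x Y T 𝒰 X by
          obtain ⟨y, hyz, -, hy⟩ := hd _ hmem rfl
          exact hyz hy
        refine ⟨Set.singleton_subset_iff.mpr (hZX hz), fun m => ?_,
          fun h => (hzne h.symm).elim⟩
        have heq : {z} ∩ (Y m \ {x m}) = ∅ :=
          Set.singleton_inter_eq_empty.mpr fun h => hZY ⟨m, z, hz, h⟩
        rw [heq]
        exact (htop m).2.2.1
      · push Not at hZxs
        obtain ⟨z, hz⟩ := hZ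
        refine ⟨z, hz, fun hd => ?_⟩
        obtain ⟨y, hyz, hyZ, -⟩ := hd X hXmem (hZX hz)
        exact hyz ((hZxs y hyZ).trans (hZxs z hz).symm)
end
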